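/- arXiv:2203.12477 — 2 statements merged into one kernel-verified Lean document; each statement's English description precedes it below -/
import Mathlib

section
/- For μ-almost every x ∈ [0,1], the binary digits of x satisfy the following: there are infinitely many n ∈ ℕ such that a_{n+1}(x) = a_{n+2}(x) = ⋯ = a_{n+⌊0.01·log_2 n⌋}(x) = 0, where a_k(x) := ⌊2^k x⌋ mod 2 is the k-th binary digit of x. -/
open MeasureTheory Filter Real

/-- The `log 2 / log 3`-dimensional Hausdorff measure restricted to the middle third
Cantor set; it coincides with the pushforward, under `(a_k)_{k≥1} ↦ ∑ 2 a_k 3^{-k}`,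
of the product over `k` of the uniform probability measure on `{0,1}`. -/
noncomputable def cantorMeasure : Measure ℝ :=
  (μH[Real.logb 3 2]).restrict cantorSet


noncomputable def ee (x : ℝ) : ℂ := Complex.exp (((2 * π * x : ℝ) : ℂ) * Complex.I)

lemma ee_add (x y : ℝ) : ee (x + y) = ee x * ee y := by
  unfold ee; rw [← Complex.exp_add]; congr 1; push_cast; ring

lemma norm_ee (x : ℝ) : ‖ee x‖ = 1 := Complex.norm_exp_ofReal_mul_I _

lemma ee_zero : ee 0 = 1 := by simp [ee]

lemma ee_sum {ι : Type*} (s : Finset ι) (f : ι → ℝ) : ee (∑ i ∈ s, f i) = ∏ i ∈ s, ee (f i) := by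
  classical
  induction s using Finset.induction_on with
  | empty => simp [ee_zero]
  | insert a s ha ih => rw [Finset.sum_insert ha, Finset.prod_insert ha, ee_add, ih]

lemma ee_conj (x : ℝ) : (starRingEnd ℂ) (ee x) = ee (-x) := by
  unfold ee; rw [← Complex.exp_conj]; congr 1
  rw [map_mul, Complex.conj_ofReal, Complex.conj_I]; push_cast; ring

lemma norm_one_add_ee (s : ℝ) : ‖1 + ee (2 * s)‖ = 2 * |cos (2 * π * s)| := by
  have : 1 + ee (2 * s) = ee s * ((2 * cos (2 * π * s) : ℝ) : ℂ) := by
    have h : ee (2 * s) = ee s * ee s := by rw [← ee_add]; congr 1; ring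
    have h1 : ee s * ee (-s) = 1 := by rw [← ee_add]; simp [ee_zero]
    have h2 : ((2 * cos (2 * π * s) : ℝ) : ℂ) = ee s + ee (-s) := by
      push_cast
      rw [Complex.two_cos]
      unfold ee; push_cast; congr 2 ; ring
    rw [h2, h, mul_add, h1]; ring
  rw [this, norm_mul, norm_ee, Complex.norm_real, Real.norm_eq_abs, abs_mul]; simp

lemma three_cos (θ : ℝ) : |cos θ| + |cos (θ + 2 * π / 3)| + |cos (θ + 2 * (2 * π / 3))| ≤ 2 := by
  have e1 : cos (2 * π / 3) = - (1 / 2) := by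
    have : 2 * π / 3 = π - π / 3 := by ring
    rw [this, cos_pi_sub, cos_pi_div_three]
  have h : cos θ + cos (θ + 2 * π / 3) + cos (θ + 2 * (2 * π / 3)) = 0 := by
    have h1 : cos θ = cos ((θ + 2 * π / 3) - 2 * π / 3) := by congr 1; ring
    have h2 : cos (θ + 2 * (2 * π / 3)) = cos ((θ + 2 * π / 3) + 2 * π / 3) := by congr 1; ring
    rw [h1, h2, cos_sub, cos_add (θ + 2 * π / 3), e1]; ring
  have b1 := abs_le.1 (abs_cos_le_one θ)
  have b2 := abs_le.1 (abs_cos_le_one (θ + 2 * π / 3))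
  have b3 := abs_le.1 (abs_cos_le_one (θ + 2 * (2 * π / 3)))
  rcases abs_cases (cos θ) with ⟨h1, _⟩ | ⟨h1, _⟩ <;>
  rcases abs_cases (cos (θ + 2 * π / 3)) with ⟨h2, _⟩ | ⟨h2, _⟩ <;>
  rcases abs_cases (cos (θ + 2 * (2 * π / 3))) with ⟨h3, _⟩ | ⟨h3, _⟩ <;>
  rw [h1, h2, h3] <;> linarith

noncomputable def Phi (k : ℕ) (t : ℝ) : ℝ := ∏ i ∈ Finset.range k, |cos (2 * π * (t / 3 ^ (i + 1)))|

lemma Phi_nonneg (k t) : 0 ≤ Phi k t := Finset.prod_nonneg fun _ _ => abs_nonneg _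

lemma Phi_le_one (k t) : Phi k t ≤ 1 :=
  Finset.prod_le_one (fun _ _ => abs_nonneg _) fun _ _ => abs_cos_le_one _

lemma Phi_neg (k t) : Phi k (-t) = Phi k t := by
  unfold Phi
  refine Finset.prod_congr rfl fun i _ => ?_
  rw [show 2 * π * (-t / 3 ^ (i + 1)) = -(2 * π * (t / 3 ^ (i + 1))) by ring, cos_neg]

lemma Phi_period (k : ℕ) (t : ℝ) (c : ℤ) : Phi k (t + 3 ^ k * c) = Phi k t := by
  unfold Phi
  refine Finset.prod_congr rfl fun i hi => ?_
  have hi : i + 1 ≤ k := Finset.mem_range.1 hi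
  obtain ⟨d, rfl⟩ := Nat.exists_eq_add_of_le hi
  have : 2 * π * ((t + 3 ^ (i + 1 + d) * c) / 3 ^ (i + 1)) =
      2 * π * (t / 3 ^ (i + 1)) + ((3 ^ d * c : ℤ) : ℝ) * (2 * π) := by
    push_cast; rw [pow_add]; field_simp
  rw [this, cos_add_int_mul_two_pi]

lemma Phi_sum (k : ℕ) : ∑ b ∈ Finset.range (3 ^ k), Phi k b ≤ 2 ^ k := by
  induction k with
  | zero => simp [Phi]
  | succ k ih =>
    have : 3 ^ (k + 1) = 3 ^ k + 3 ^ k + 3 ^ k := by ring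
    rw [this, Finset.sum_range_add, Finset.sum_range_add, ← Finset.sum_add_distrib,
      ← Finset.sum_add_distrib, pow_succ, mul_comm]
    refine le_trans ?_ (mul_le_mul_of_nonneg_left ih zero_le_two)
    rw [Finset.mul_sum]
    refine Finset.sum_le_sum fun b _ => ?_
    have h1 := Phi_period k b 1
    have h2 := Phi_period k b 2
    have s : ∀ t, Phi (k + 1) t = Phi k t * |cos (2 * π * (t / 3 ^ (k + 1)))| := fun t =>
      Finset.prod_range_succ _ _
    push_cast at h1 h2 ⊢
    rw [s, s, s, show (3 ^ k + b : ℝ) = b + 3 ^ k * 1 by ring, h1,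
      show (3 ^ k + 3 ^ k + b : ℝ) = b + 3 ^ k * 2 by ring, h2]
    have h3 := three_cos (2 * π * (b / 3 ^ (k + 1)))
    rw [show 2 * π * ((b + 3 ^ k * 1 : ℝ) / 3 ^ (k + 1)) = 2 * π * (b / 3 ^ (k + 1)) + 2 * π / 3 by
        rw [pow_succ]; field_simp,
      show 2 * π * ((b + 3 ^ k * 2 : ℝ) / 3 ^ (k + 1)) =
        2 * π * (b / 3 ^ (k + 1)) + 2 * (2 * π / 3) by
        rw [pow_succ]; field_simp]
    nlinarith [Phi_nonneg k b]

lemma two_pow_order (k d : ℕ) (h : (3 : ℤ) ^ (k + 1) ∣ 2 ^ d - 1) (hd : d < 3 ^ k) : d = 0 := by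
  by_contra h0
  have h4 : (3 : ℤ) ^ (k + 1) ∣ 4 ^ d - 1 ^ d := by
    have : (4 : ℤ) ^ d - 1 ^ d = (2 ^ d - 1) * (2 ^ d + 1) := by
      rw [show (4 : ℤ) = 2 * 2 by norm_num, mul_pow]; ring
    rw [this]; exact Dvd.dvd.mul_right h _
  have hl := Int.emultiplicity_pow_sub_pow (p := 3) (by norm_num) (by decide) (x := 4) (y := 1)
    (by norm_num) (by norm_num) d
  have h1 : emultiplicity ((3:ℕ):ℤ) (4 - 1) = 1 := by
    have : (4 - 1 : ℤ) = ((3:ℕ) : ℤ) := by norm_num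
    rw [this]
    exact (FiniteMultiplicity.emultiplicity_self (by
      apply Int.finiteMultiplicity_iff.2; norm_num))
  have h2 := le_emultiplicity_of_pow_dvd (a := ((3:ℕ):ℤ)) h4
  rw [hl, h1] at h2
  push_cast at h2
  rw [add_comm] at h2
  have h3 : (k : ℕ∞) ≤ emultiplicity 3 d := by
    exact (ENat.add_le_add_iff_left (by simp)).1 h2
  have h5 := pow_dvd_of_le_emultiplicity h3
  have := Nat.le_of_dvd (Nat.pos_of_ne_zero h0) h5
  omega

lemma two_pow_inj (k : ℕ) (u : ℤ) (hu : ¬ 3 ∣ u) (n m : ℕ) (hnm : n ≤ m) (hm : m < 3 ^ k)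
    (h : (3 : ℤ) ^ (k + 1) ∣ u * 2 ^ m - u * 2 ^ n) : n = m := by
  have : u * 2 ^ m - u * 2 ^ n = (u * 2 ^ n) * (2 ^ (m - n) - 1) := by
    conv_lhs => rw [← Nat.add_sub_cancel' hnm, pow_add]
    ring
  rw [this] at h
  have hp : Prime (3 : ℤ) := Int.prime_three
  have hc : IsCoprime ((3 : ℤ) ^ (k + 1)) (u * 2 ^ n) := by
    apply IsCoprime.pow_left
    apply IsCoprime.mul_right
    · exact (hp.coprime_iff_not_dvd).2 hu
    · apply IsCoprime.pow_right; exact ⟨1, -1, by norm_num⟩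
  have := two_pow_order k (m - n) (hc.dvd_of_dvd_mul_left h) (by omega)
  omega

lemma Phi_unit_sum (k : ℕ) (u : ℤ) (hu : ¬ 3 ∣ u) :
    ∑ n ∈ Finset.range (3 ^ k), Phi (k + 1) ((u : ℝ) * 2 ^ n) ≤ 2 ^ (k + 1) := by
  refine le_trans ?_ (Phi_sum (k + 1))
  set g : ℕ → ℕ := fun n => ((u * 2 ^ n) % 3 ^ (k + 1)).toNat with hg
  have h3 : (0 : ℤ) < 3 ^ (k + 1) := by positivity
  have hgc : ∀ n, ((g n : ℕ) : ℤ) = (u * 2 ^ n) % 3 ^ (k + 1) := fun n =>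
    Int.toNat_of_nonneg (Int.emod_nonneg _ h3.ne')
  have hv : ∀ n, Phi (k + 1) ((u : ℝ) * 2 ^ n) = Phi (k + 1) (g n) := by
    intro n
    have := Int.emod_add_mul_ediv (u * 2 ^ n) (3 ^ (k + 1))
    rw [← hgc] at this
    rw [← Phi_period (k + 1) (g n) (u * 2 ^ n / 3 ^ (k + 1))]
    congr 1
    exact_mod_cast this.symm
  have hinj : Set.InjOn g (Finset.range (3 ^ k)) := by
    intro n hn m hm h
    have hn : n < 3 ^ k := by simpa using hn
    have hm : m < 3 ^ k := by simpa using hm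
    have h' : (u * 2 ^ n) % 3 ^ (k + 1) = (u * 2 ^ m) % 3 ^ (k + 1) := by
      rw [← hgc, ← hgc, h]
    have hd := Int.ModEq.dvd h'
    rcases le_total n m with hnm | hnm
    · exact two_pow_inj k u hu n m hnm hm hd
    · exact (two_pow_inj k u hu m n hnm hn (Int.ModEq.dvd h'.symm)).symm
  rw [Finset.sum_congr rfl fun n _ => hv n, ← Finset.sum_image (f := fun b : ℕ => Phi (k+1) b) hinj]
  refine Finset.sum_le_sum_of_subset_of_nonneg ?_ fun _ _ _ => Phi_nonneg _ _
  intro b hb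
  obtain ⟨n, _, rfl⟩ := Finset.mem_image.1 hb
  have := Int.emod_lt_of_pos (u * 2 ^ n) h3
  rw [← hgc] at this
  rw [Finset.mem_range]
  exact_mod_cast this

lemma Phi_drop (v l K : ℕ) (h : v + l ≤ K) (t : ℝ) : Phi K (3 ^ v * t) ≤ Phi l t := by
  obtain ⟨d, rfl⟩ := Nat.exists_eq_add_of_le h
  unfold Phi
  rw [Finset.prod_range_add, Finset.prod_range_add]
  have e : ∏ x ∈ Finset.range l, |cos (2 * π * (3 ^ v * t / 3 ^ (v + x + 1)))| = Phi l t := by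
    refine Finset.prod_congr rfl fun i _ => ?_
    congr 3
    rw [show v + i + 1 = v + (i + 1) by ring, pow_add]; field_simp
  rw [e]
  have hA := Phi_le_one v (3 ^ v * t)
  have hA0 := Phi_nonneg v (3 ^ v * t)
  have hB0 : 0 ≤ ∏ x ∈ Finset.range d, |cos (2 * π * (3 ^ v * t / 3 ^ (v + l + x + 1)))| :=
    Finset.prod_nonneg fun _ _ => abs_nonneg _
  have hB1 : ∏ x ∈ Finset.range d, |cos (2 * π * (3 ^ v * t / 3 ^ (v + l + x + 1)))| ≤ 1 :=
    Finset.prod_le_one (fun _ _ => abs_nonneg _) fun _ _ => abs_cos_le_one _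
  unfold Phi at hA hA0
  have h0 := Phi_nonneg l t
  calc _ ≤ (1 * Phi l t) * 1 := by gcongr
    _ = _ := by unfold Phi; ring

lemma Phi_int_sum (k V K : ℕ) (q : ℤ) (hq : q ≠ 0) (hqV : |q| < 3 ^ V) (hK : V + k + 1 ≤ K) :
    ∑ n ∈ Finset.range (3 ^ k), Phi K ((q : ℝ) * 2 ^ n) ≤ 2 ^ (k + 1) := by
  have hf : FiniteMultiplicity (3 : ℤ) q := Int.finiteMultiplicity_iff.2 ⟨by norm_num, hq⟩
  obtain ⟨u, hu, hu3⟩ := hf.exists_eq_pow_mul_and_not_dvd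
  set v := multiplicity (3 : ℤ) q
  have hv : v < V := by
    have h1 : (3 : ℤ) ^ v ≤ |q| := Int.le_of_dvd (abs_pos.2 hq) ((dvd_abs _ _).2 ⟨u, hu⟩)
    have h2 : (3 : ℤ) ^ v < 3 ^ V := lt_of_le_of_lt h1 hqV
    exact (pow_lt_pow_iff_right₀ (by norm_num)).1 h2
  refine le_trans (Finset.sum_le_sum fun n _ => ?_) (Phi_unit_sum k u hu3)
  have : (q : ℝ) * 2 ^ n = 3 ^ v * ((u : ℝ) * 2 ^ n) := by
    rw [hu]; push_cast; ring
  rw [this]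
  exact Phi_drop v (k + 1) K (by omega) _

noncomputable def yy (K : ℕ) (a : Fin K → Bool) : ℝ :=
  ∑ i, (if a i then 2 else 0) / 3 ^ ((i : ℕ) + 1)

lemma char_sum (K : ℕ) (t : ℝ) : ‖∑ a : Fin K → Bool, ee (t * yy K a)‖ = 2 ^ K * Phi K t := by
  have h1 : ∀ a : Fin K → Bool, ee (t * yy K a) =
      ∏ i : Fin K, (fun (i : Fin K) (b : Bool) => if b then ee (2 * (t / 3 ^ ((i : ℕ) + 1))) else 1) i (a i) := by
    intro a
    unfold yy
    rw [Finset.mul_sum, ee_sum]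
    refine Finset.prod_congr rfl fun i _ => ?_
    by_cases h : a i
    · simp only [h, if_true]; congr 1; ring
    · simp [h, ee_zero]
  rw [Finset.sum_congr rfl fun a _ => h1 a]
  have hps := Fintype.prod_sum (fun (i : Fin K) (b : Bool) =>
    if b then ee (2 * (t / 3 ^ ((i : ℕ) + 1))) else 1)
  rw [← hps, norm_prod]
  simp only [Fintype.univ_bool, Finset.mem_singleton, Bool.true_eq_false, not_false_eq_true, Finset.sum_insert, Finset.sum_singleton, if_true, Bool.false_eq_true, if_false]
  unfold Phi
  rw [← Fin.prod_univ_eq_prod_range (fun i => |cos (2 * π * (t / 3 ^ (i + 1)))|)]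
  have : (2 : ℝ) ^ K = ∏ i : Fin K, 2 := by simp
  rw [this, ← Finset.prod_mul_distrib]
  refine Finset.prod_congr rfl fun i _ => ?_
  rw [add_comm, norm_one_add_ee]

/-- second moment -/
lemma second_moment (k V K : ℕ) (q : ℤ) (hq : q ≠ 0) (hqV : |q| * 2 ^ (3 ^ k) < 3 ^ V)
    (hK : V + k + 1 ≤ K) :
    ∑ a : Fin K → Bool, ‖∑ n ∈ Finset.range (3 ^ k), ee ((q : ℝ) * 2 ^ n * yy K a)‖ ^ 2 ≤
      2 ^ K * (5 * 3 ^ k * 2 ^ k) := by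
  set R := Finset.range (3 ^ k) with hR
  -- pairs
  have hpair : ∑ n ∈ R, ∑ m ∈ R, Phi K ((q : ℝ) * 2 ^ n - q * 2 ^ m) ≤ 5 * 3 ^ k * 2 ^ k := by
    -- the bound for ordered pairs
    have hord : ∑ n ∈ R, ∑ m ∈ R, (if n < m then Phi K ((q : ℝ) * 2 ^ m - q * 2 ^ n) else 0)
        ≤ 3 ^ k * 2 ^ (k + 1) := by
      have h1 : ∀ n ∈ R, ∑ m ∈ R, (if n < m then Phi K ((q : ℝ) * 2 ^ m - q * 2 ^ n) else 0) ≤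
          ∑ d ∈ R, (if 0 < d then Phi K (((q * (2 ^ d - 1) : ℤ) : ℝ) * 2 ^ n) else 0) := by
        intro n _
        rw [← Finset.sum_filter]
        set S := R.filter (fun m => n < m) with hS
        have hinj : Set.InjOn (fun m => m - n) (S : Set ℕ) := by
          intro m hm m' hm' h
          simp [hS] at hm hm'
          simp at h
          omega
        have : ∑ m ∈ S, Phi K ((q : ℝ) * 2 ^ m - q * 2 ^ n) =
            ∑ d ∈ S.image (fun m => m - n),
              (if 0 < d then Phi K (((q * (2 ^ d - 1) : ℤ) : ℝ) * 2 ^ n) else 0) := by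
          rw [Finset.sum_image hinj]
          refine Finset.sum_congr rfl fun m hm => ?_
          have hm : n < m := (Finset.mem_filter.1 hm).2
          rw [if_pos (by omega)]
          congr 1
          obtain ⟨d, rfl⟩ := Nat.exists_eq_add_of_le hm.le
          rw [Nat.add_sub_cancel_left]; push_cast; rw [pow_add]; ring
        rw [this]
        refine Finset.sum_le_sum_of_subset_of_nonneg ?_ ?_
        · intro d hd
          obtain ⟨m, hm, rfl⟩ := Finset.mem_image.1 hd
          have := (Finset.mem_filter.1 hm).1
          rw [hR, Finset.mem_range] at this ⊢
          omega
        · intro d _ _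
          split_ifs
          · exact Phi_nonneg _ _
          · exact le_rfl
      refine (Finset.sum_le_sum h1).trans ?_
      rw [Finset.sum_comm]
      have h2 : ∀ d ∈ R, ∑ n ∈ R,
          (if 0 < d then Phi K (((q * (2 ^ d - 1) : ℤ) : ℝ) * 2 ^ n) else 0) ≤ 2 ^ (k + 1) := by
        intro d hd
        rcases Nat.eq_zero_or_pos d with h0 | h0
        · simp [h0]
        · simp only [h0, if_true]
          have hd2 : (2 : ℤ) ≤ 2 ^ d := by
            calc (2 : ℤ) = 2 ^ 1 := by norm_num
              _ ≤ 2 ^ d := pow_le_pow_right₀ (by norm_num) h0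
          refine Phi_int_sum k V K _ (mul_ne_zero hq (by omega)) ?_ hK
          refine lt_of_le_of_lt ?_ hqV
          rw [abs_mul]
          refine mul_le_mul_of_nonneg_left ?_ (abs_nonneg _)
          rw [abs_of_nonneg (by omega)]
          have : (2 : ℤ) ^ d ≤ 2 ^ (3 ^ k) :=
            pow_le_pow_right₀ (by norm_num) (Finset.mem_range.1 hd).le
          omega
      refine (Finset.sum_le_sum h2).trans ?_
      simp [hR]
    have hsplit : ∀ n ∈ R, ∀ m ∈ R, Phi K ((q : ℝ) * 2 ^ n - q * 2 ^ m) ≤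
        (if n = m then 1 else 0) + (if n < m then Phi K ((q : ℝ) * 2 ^ m - q * 2 ^ n) else 0) +
        (if m < n then Phi K ((q : ℝ) * 2 ^ n - q * 2 ^ m) else 0) := by
      intro n _ m _
      rcases lt_trichotomy n m with h | h | h
      · rw [if_neg h.ne, if_pos h, if_neg h.le.not_gt, ← Phi_neg]; simp
      · rw [if_pos h]; simp [h, Phi_le_one]
      · rw [if_neg h.ne', if_neg h.le.not_gt, if_pos h]; simp
    refine (Finset.sum_le_sum fun n hn => Finset.sum_le_sum fun m hm => hsplit n hn m hm).trans ?_
    simp only [Finset.sum_add_distrib]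
    have hdiag : ∑ n ∈ R, ∑ m ∈ R, (if n = m then (1 : ℝ) else 0) = 3 ^ k := by
      have : ∀ n ∈ R, ∑ m ∈ R, (if n = m then (1 : ℝ) else 0) = 1 := fun n hn => by
        rw [Finset.sum_ite_eq, if_pos hn]
      rw [Finset.sum_congr rfl this]; simp [hR]
    have hord2 := hord
    rw [Finset.sum_comm] at hord2
    rw [hdiag]
    have : (1 : ℝ) ≤ 2 ^ k := one_le_pow₀ (by norm_num)
    have h3 : (0 : ℝ) < 3 ^ k := by positivity
    rw [pow_succ] at hord hord2
    nlinarith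
  have hsq : ∀ a : Fin K → Bool,
      ((‖∑ n ∈ R, ee ((q : ℝ) * 2 ^ n * yy K a)‖ ^ 2 : ℝ) : ℂ) =
      ∑ n ∈ R, ∑ m ∈ R, ee (((q : ℝ) * 2 ^ n - q * 2 ^ m) * yy K a) := by
    intro a
    push_cast
    rw [← Complex.mul_conj', map_sum, Finset.sum_mul_sum]
    refine Finset.sum_congr rfl fun n _ => Finset.sum_congr rfl fun m _ => ?_
    rw [ee_conj, ← ee_add]; congr 1; ring
  have hnn : 0 ≤ ∑ a : Fin K → Bool, ‖∑ n ∈ R, ee ((q : ℝ) * 2 ^ n * yy K a)‖ ^ 2 :=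
    Finset.sum_nonneg fun _ _ => by positivity
  rw [← abs_of_nonneg hnn, ← Real.norm_eq_abs, ← Complex.norm_real, Complex.ofReal_sum,
    Finset.sum_congr rfl fun a _ => hsq a, Finset.sum_comm]
  refine (norm_sum_le _ _).trans ?_
  refine le_trans (Finset.sum_le_sum (g := fun n => ∑ m ∈ R,
    2 ^ K * Phi K ((q : ℝ) * 2 ^ n - q * 2 ^ m)) fun n _ => ?_) ?_
  · rw [Finset.sum_comm]
    refine (norm_sum_le _ _).trans ?_
    exact Finset.sum_le_sum fun m _ => (char_sum K _).le
  · simp only [← Finset.mul_sum]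
    exact mul_le_mul_of_nonneg_left hpair (by positivity)

/-- trigonometric expansion -/
noncomputable def ww (m i : ℕ) : ℝ := (Nat.choose (2 * m) i : ℝ) / 4 ^ m

lemma ww_nonneg (m i) : 0 ≤ ww m i := by unfold ww; positivity

lemma ww_sum (m : ℕ) : ∑ i ∈ Finset.range (2 * m + 1), ww m i = 1 := by
  unfold ww
  rw [← Finset.sum_div]
  have := Nat.sum_range_choose (2 * m)
  have h : ∑ i ∈ Finset.range (2 * m + 1), (Nat.choose (2 * m) i : ℝ) = 2 ^ (2 * m) := by
    exact_mod_cast this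
  rw [h, pow_mul]; norm_num

lemma ww_mid (m : ℕ) (hm : 0 < m) : 1 / (2 * m) ≤ ww m m := by
  have := Nat.four_pow_le_two_mul_self_mul_centralBinom m hm
  rw [Nat.centralBinom] at this
  have h : (4 : ℝ) ^ m ≤ 2 * m * (Nat.choose (2 * m) m : ℝ) := by exact_mod_cast this
  unfold ww
  rw [div_le_div_iff₀ (by positivity) (by positivity)]
  linarith

lemma ee_nat_mul (n : ℕ) (s : ℝ) : ee (n * s) = ee s ^ n := by
  unfold ee; rw [← Complex.exp_nat_mul]; congr 1; push_cast; ring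

lemma trig_expand (m : ℕ) (s : ℝ) : (((cos (π * s) ^ 2) ^ m : ℝ) : ℂ) =
    ∑ i ∈ Finset.range (2 * m + 1), (ww m i : ℂ) * ee (((i : ℝ) - m) * s) := by
  have h1 : ((cos (π * s) : ℝ) : ℂ) = (ee (s / 2) + ee (-(s / 2))) / 2 := by
    have := Complex.two_cos ((π * s : ℝ) : ℂ)
    push_cast
    rw [eq_div_iff two_ne_zero, mul_comm]
    push_cast at this
    rw [this]; unfold ee; push_cast; congr 2 <;> ring
  rw [← pow_mul]
  push_cast [h1]
  rw [div_pow, add_pow, Finset.sum_div]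
  refine Finset.sum_congr rfl fun i hi => ?_
  have hi : i ≤ 2 * m := by have := Finset.mem_range.1 hi; omega
  rw [← ee_nat_mul, ← ee_nat_mul, ← ee_add]
  unfold ww
  push_cast [Nat.cast_sub hi]
  rw [show (i : ℝ) * (s / 2) + (2 * m - i) * (-(s / 2)) = (i - m) * s by ring]
  rw [pow_mul]; norm_num; ring

/-- outside the target -/
lemma cos_outside (c s : ℝ) (m : ℕ) (hc : 0 < c) (hc2 : c ≤ 1 / 2) (hm : (m : ℝ) * c ^ 4 = 1)
    (hs : 2 * c ≤ Int.fract s) : (cos (π * (s - c)) ^ 2) ^ m ≤ 1 / (8 * m) := by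
  have hmpos : (0 : ℝ) < m := by
    rcases Nat.eq_zero_or_pos m with h | h
    · simp [h] at hm
    · exact_mod_cast h
  set f := Int.fract s with hf
  have hf1 : f < 1 := Int.fract_lt_one s
  have hper : cos (π * (s - c)) ^ 2 = cos (π * (f - c)) ^ 2 := by
    have : π * (s - c) = π * (f - c) + ⌊s⌋ * π := by
      have := Int.fract_add_floor s
      rw [← hf] at this
      linear_combination π * (-this)
    rw [this, cos_add_int_mul_pi, mul_pow]
    rw [← abs_sq ((-1 : ℝ) ^ ⌊s⌋)]; simp
  have hsin : 2 * c ≤ sin (π * (f - c)) := by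
    have hp := pi_pos
    rcases le_total (f - c) (1 / 2) with h | h
    · have := mul_le_sin (x := π * (f - c)) (by apply mul_nonneg hp.le; linarith) (by nlinarith)
      have e : 2 / π * (π * (f - c)) = 2 * (f - c) := by field_simp
      rw [e] at this; linarith
    · have := mul_le_sin (x := π * (1 - (f - c))) (by apply mul_nonneg hp.le; linarith) (by nlinarith)
      have e : 2 / π * (π * (1 - (f - c))) = 2 * (1 - (f - c)) := by field_simp
      rw [e, show π * (1 - (f - c)) = π - π * (f - c) by ring, sin_pi_sub] at this; linarith
  have hcos : cos (π * (f - c)) ^ 2 ≤ exp (-(4 * c ^ 2)) := by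
    have h1 := sin_sq_add_cos_sq (π * (f - c))
    have h2 := add_one_le_exp (-(4 * c ^ 2))
    nlinarith
  rw [hper]
  calc (cos (π * (f - c)) ^ 2) ^ m ≤ (exp (-(4 * c ^ 2))) ^ m := by gcongr
    _ = exp (-(m * (4 * c ^ 2))) := by rw [← exp_nat_mul]; congr 1; ring
    _ ≤ 1 / (8 * m) := by
      rw [exp_neg, one_div]
      refine inv_anti₀ (by positivity) ?_
      have h := quadratic_le_exp_of_nonneg (x := m * (4 * c ^ 2)) (by positivity)
      have : (m * (4 * c ^ 2)) ^ 2 / 2 = 8 * m := by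
        calc (m * (4 * c ^ 2)) ^ 2 / 2 = 8 * m * (m * c ^ 4) := by ring
          _ = _ := by rw [hm, mul_one]
      have h0 : 0 ≤ m * (4 * c ^ 2) := by positivity
      linarith

/-- count of bad cylinders -/
lemma bad_count (k V K m : ℕ) (c : ℝ) (hc : 0 < c) (hc2 : c ≤ 1 / 2) (hm : (m : ℝ) * c ^ 4 = 1)
    (hV : (m : ℤ) * 2 ^ (3 ^ k) * 2 ^ (3 ^ k) < 3 ^ V) (hK : V + k + 1 ≤ K)
    (B : Finset (Fin K → Bool))
    (hB : ∀ a ∈ B, ∀ n < 3 ^ k, 2 * c ≤ Int.fract (2 ^ (3 ^ k + n) * yy K a)) :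
    (B.card : ℝ) ≤ 2 ^ K * (80 * m ^ 2 * 2 ^ k / 3 ^ k) := by
  have hmpos' : 0 < m := by
    rcases Nat.eq_zero_or_pos m with h | h
    · simp [h] at hm
    · exact h
  have hmpos : (0 : ℝ) < m := by exact_mod_cast hmpos'
  set R := Finset.range (3 ^ k) with hR
  set I := (Finset.range (2 * m + 1)).erase m with hI
  have hmI : m ∈ Finset.range (2 * m + 1) := by simp; omega
  set q : ℕ → ℤ := fun i => ((i : ℤ) - m) * 2 ^ (3 ^ k) with hq
  set T : ℕ → (Fin K → Bool) → ℂ := fun i a =>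
    ∑ n ∈ R, ee ((q i : ℝ) * 2 ^ n * yy K a) with hT
  have hTsum : ∀ i ∈ I, ∑ a, ‖T i a‖ ^ 2 ≤ 2 ^ K * (5 * 3 ^ k * 2 ^ k) := by
    intro i hi
    have hi1 := Finset.ne_of_mem_erase hi
    have hi2 := Finset.mem_range.1 (Finset.mem_of_mem_erase hi)
    refine second_moment k V K (q i) ?_ ?_ hK
    · apply mul_ne_zero
      · omega
      · positivity
    · refine lt_of_le_of_lt ?_ hV
      refine mul_le_mul_of_nonneg_right ?_ (by positivity)
      simp only [hq]
      rw [abs_mul, abs_of_nonneg (a := (2 : ℤ) ^ (3 ^ k)) (by positivity)]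
      refine mul_le_mul_of_nonneg_right ?_ (by positivity)
      rw [abs_le]; constructor <;> omega
  -- pointwise lower bound
  have hlow : ∀ a ∈ B, (3 ^ k / (4 * m : ℝ)) ^ 2 ≤ ∑ i ∈ I, ww m i * ‖T i a‖ ^ 2 := by
    intro a ha
    have hexp : ((∑ n ∈ R, ((cos (π * (2 ^ (3 ^ k + n) * yy K a - c)) ^ 2) ^ m - ww m m) : ℝ) : ℂ)
        = ∑ i ∈ I, (ww m i : ℂ) * ee (-(((i : ℝ) - m) * c)) * T i a := by
      simp only [hT, Finset.mul_sum]
      rw [Finset.sum_comm, Complex.ofReal_sum]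
      refine Finset.sum_congr rfl fun n _ => ?_
      rw [Complex.ofReal_sub, trig_expand, ← Finset.add_sum_erase _ _ hmI]
      rw [sub_self, zero_mul, ee_zero, mul_one, add_sub_cancel_left]
      refine Finset.sum_congr rfl fun i _ => ?_
      rw [mul_assoc, ← ee_add]
      congr 2
      simp only [hq]; push_cast; rw [pow_add]; ring
    have hup : ∑ n ∈ R, ((cos (π * (2 ^ (3 ^ k + n) * yy K a - c)) ^ 2) ^ m - ww m m) ≤
        -(3 ^ k / (4 * m : ℝ)) := by
      refine le_trans (Finset.sum_le_sum (g := fun _ => -(1 / (4 * m : ℝ))) fun n hn => ?_) ?_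
      · have h1 := cos_outside c _ m hc hc2 hm (hB a ha n (Finset.mem_range.1 hn))
        have h2 := ww_mid m hmpos'
        have e1 : 1 / (8 * m : ℝ) = (1 / m) / 8 := by field_simp
        have e2 : 1 / (4 * m : ℝ) = (1 / m) / 4 := by field_simp
        have e3 : 1 / (2 * m : ℝ) = (1 / m) / 2 := by field_simp
        have e4 : 0 < 1 / (m : ℝ) := by positivity
        rw [e1] at h1; rw [e3] at h2; rw [e2]; linarith
      · simp [hR]; apply le_of_eq; field_simp
    have hnorm : 3 ^ k / (4 * m : ℝ) ≤ ∑ i ∈ I, ww m i * ‖T i a‖ := by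
      calc 3 ^ k / (4 * m : ℝ)
          ≤ |∑ n ∈ R, ((cos (π * (2 ^ (3 ^ k + n) * yy K a - c)) ^ 2) ^ m - ww m m)| := by
            rw [le_abs]; right; linarith
        _ = ‖∑ i ∈ I, (ww m i : ℂ) * ee (-(((i : ℝ) - m) * c)) * T i a‖ := by
            rw [← hexp, Complex.norm_real, Real.norm_eq_abs]
        _ ≤ _ := by
            refine (norm_sum_le _ _).trans (Finset.sum_le_sum fun i _ => ?_)
            rw [norm_mul, norm_mul, norm_ee, Complex.norm_real, Real.norm_eq_abs,
              abs_of_nonneg (ww_nonneg m i), mul_one]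
    have hw1 : ∑ i ∈ I, ww m i ≤ 1 := by
      rw [← ww_sum m]
      exact Finset.sum_le_sum_of_subset_of_nonneg (Finset.erase_subset _ _)
        fun _ _ _ => ww_nonneg _ _
    have hcs : (∑ i ∈ I, ww m i * ‖T i a‖) ^ 2 ≤
        (∑ i ∈ I, ww m i) * ∑ i ∈ I, ww m i * ‖T i a‖ ^ 2 := by
      refine Finset.sum_sq_le_sum_mul_sum_of_sq_le_mul _ (fun i _ => ww_nonneg m i)
        (fun i _ => mul_nonneg (ww_nonneg m i) (by positivity)) fun i _ => le_of_eq (by ring)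
    have hnn : 0 ≤ ∑ i ∈ I, ww m i * ‖T i a‖ ^ 2 :=
      Finset.sum_nonneg fun i _ => mul_nonneg (ww_nonneg m i) (by positivity)
    calc (3 ^ k / (4 * m : ℝ)) ^ 2 ≤ (∑ i ∈ I, ww m i * ‖T i a‖) ^ 2 := by gcongr
      _ ≤ _ := hcs
      _ ≤ 1 * ∑ i ∈ I, ww m i * ‖T i a‖ ^ 2 := by gcongr
      _ = _ := one_mul _
  have hw1 : ∑ i ∈ I, ww m i ≤ 1 := by
    rw [← ww_sum m]
    exact Finset.sum_le_sum_of_subset_of_nonneg (Finset.erase_subset _ _)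
      fun _ _ _ => ww_nonneg _ _
  have htot : (B.card : ℝ) * (3 ^ k / (4 * m : ℝ)) ^ 2 ≤ 2 ^ K * (5 * 3 ^ k * 2 ^ k) := by
    calc (B.card : ℝ) * (3 ^ k / (4 * m : ℝ)) ^ 2 = ∑ a ∈ B, (3 ^ k / (4 * m : ℝ)) ^ 2 := by simp
      _ ≤ ∑ a ∈ B, ∑ i ∈ I, ww m i * ‖T i a‖ ^ 2 := Finset.sum_le_sum hlow
      _ ≤ ∑ a, ∑ i ∈ I, ww m i * ‖T i a‖ ^ 2 :=
        Finset.sum_le_sum_of_subset_of_nonneg (Finset.subset_univ _) fun a _ _ =>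
          Finset.sum_nonneg fun i _ => mul_nonneg (ww_nonneg m i) (by positivity)
      _ = ∑ i ∈ I, ww m i * ∑ a, ‖T i a‖ ^ 2 := by
        rw [Finset.sum_comm]; simp only [Finset.mul_sum]
      _ ≤ ∑ i ∈ I, ww m i * (2 ^ K * (5 * 3 ^ k * 2 ^ k)) :=
        Finset.sum_le_sum fun i hi => mul_le_mul_of_nonneg_left (hTsum i hi) (ww_nonneg m i)
      _ = (∑ i ∈ I, ww m i) * (2 ^ K * (5 * 3 ^ k * 2 ^ k)) := by rw [Finset.sum_mul]
      _ ≤ 1 * (2 ^ K * (5 * 3 ^ k * 2 ^ k)) := by gcongr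
      _ = _ := one_mul _
  have h3 : (0 : ℝ) < 3 ^ k := by positivity
  calc (B.card : ℝ) = (B.card : ℝ) * (3 ^ k / (4 * m : ℝ)) ^ 2 * (16 * m ^ 2 / (3 ^ k) ^ 2) := by
        field_simp; norm_num
    _ ≤ 2 ^ K * (5 * 3 ^ k * 2 ^ k) * (16 * m ^ 2 / (3 ^ k) ^ 2) := by gcongr
    _ = _ := by field_simp; norm_num

lemma pre_cover (K : ℕ) : ∀ x ∈ preCantorSet K, ∃ a : Fin K → Bool,
    yy K a ≤ x ∧ x ≤ yy K a + (1 / 3) ^ K := by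
  induction K with
  | zero =>
    intro x hx
    simp only [preCantorSet_zero, Set.mem_Icc] at hx
    exact ⟨fun _ => false, by simpa [yy] using hx.1, by simpa [yy] using hx.2⟩
  | succ K ih =>
    have hcons : ∀ (b : Bool) (a : Fin K → Bool),
        yy (K + 1) (Fin.cons b a) = ((if b then 2 else 0) + yy K a) / 3 := by
      intro b a
      unfold yy
      rw [Fin.sum_univ_succ, add_div, Finset.sum_div]
      congr 1
      · simp
      · refine Finset.sum_congr rfl fun i _ => ?_
        simp only [Fin.cons_succ, Fin.val_succ]
        rw [div_div, ← pow_succ]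
    intro x hx
    rw [preCantorSet_succ] at hx
    rcases hx with ⟨z, hz, rfl⟩ | ⟨z, hz, rfl⟩
    · obtain ⟨a, h1, h2⟩ := ih z hz
      refine ⟨Fin.cons false a, ?_, ?_⟩
      · rw [hcons]; simp; linarith
      · rw [hcons, pow_succ]; simp only [Bool.false_eq_true, if_false]; linarith
    · obtain ⟨a, h1, h2⟩ := ih z hz
      refine ⟨Fin.cons true a, ?_, ?_⟩
      · rw [hcons]; simp only [if_true]; linarith
      · rw [hcons, pow_succ]; simp only [if_true]; linarith

lemma works_of (n L : ℕ) (x : ℝ) (z : ℤ) (h0 : 0 ≤ 2 ^ n * x - z)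
    (h1 : 2 ^ L * (2 ^ n * x - z) < 1) (j : ℕ) (hj : n + 1 ≤ j) (hj2 : j ≤ n + L) :
    ⌊(2 : ℝ) ^ j * x⌋ % 2 = 0 := by
  obtain ⟨i, rfl⟩ := Nat.exists_eq_add_of_le hj
  have hf : ⌊(2 : ℝ) ^ (n + 1 + i) * x⌋ = 2 * (2 ^ i * z) := by
    rw [Int.floor_eq_iff]
    have e : (2 : ℝ) ^ (n + 1 + i) * x = 2 * 2 ^ i * z + 2 ^ (i + 1) * (2 ^ n * x - z) := by
      rw [pow_add, pow_add, pow_succ]; ring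
    rw [e]
    have h2 : (2 : ℝ) ^ (i + 1) * (2 ^ n * x - z) ≤ 2 ^ L * (2 ^ n * x - z) := by
      refine mul_le_mul_of_nonneg_right ?_ h0
      exact pow_le_pow_right₀ (by norm_num) (by omega)
    have h3 : 0 ≤ (2 : ℝ) ^ (i + 1) * (2 ^ n * x - z) := by positivity
    push_cast
    constructor <;> linarith
  rw [hf]; omega

lemma log_bound (j n : ℕ) (h0 : 0 < n) (h : n < 2 * 3 ^ (50 * j)) :
    ⌊0.01 * Real.logb 2 n⌋₊ ≤ j + 1 := by
  have h1 : (n : ℝ) ≤ 2 ^ (100 * (j + 1)) := by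
    have : n ≤ 2 ^ (100 * (j + 1)) := by
      calc n ≤ 2 * 3 ^ (50 * j) := h.le
        _ ≤ 2 ^ 100 * 4 ^ (50 * j) := by gcongr <;> norm_num
        _ = 2 ^ (100 * (j + 1)) := by
          rw [show (4 : ℕ) = 2 ^ 2 by norm_num, ← pow_mul, ← pow_add]; congr 1; ring
    exact_mod_cast this
  have h2 : Real.logb 2 n ≤ 100 * (j + 1) := by
    rw [Real.logb_le_iff_le_rpow (by norm_num) (by exact_mod_cast h0)]
    exact_mod_cast h1
  have h3 : 0.01 * Real.logb 2 n ≤ ((j + 1 : ℕ) : ℝ) := by push_cast; linarith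
  exact Nat.floor_le_of_le h3

def BadSet (M : ℕ) : Set ℝ := {x | x ∈ cantorSet ∧ ∀ n, M ≤ n →
  ¬ ∀ j : ℕ, n + 1 ≤ j → j ≤ n + ⌊0.01 * Real.logb 2 n⌋₊ → ⌊(2 : ℝ) ^ j * x⌋ % 2 = 0}

def mj (j : ℕ) : ℕ := 2 ^ (4 * (j + 3))
def Vj (j : ℕ) : ℕ := mj j * 2 ^ (3 ^ (50 * j)) * 2 ^ (3 ^ (50 * j))
def Kj (j : ℕ) : ℕ := Vj j + 50 * j + 1 + (2 * 3 ^ (50 * j) + j + 3)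

open Classical in
noncomputable def Bj (j : ℕ) : Finset (Fin (Kj j) → Bool) :=
  Finset.univ.filter fun a => ∀ n < 3 ^ (50 * j),
    2 * (1 / 2) ^ (j + 3) ≤ Int.fract (2 ^ (3 ^ (50 * j) + n) * yy (Kj j) a)

lemma Bj_card (j : ℕ) : ((Bj j).card : ℝ) ≤ 2 ^ (Kj j) * (80 * 2 ^ 24 * (2 ^ 58 / 3 ^ 50) ^ j) := by
  have h := bad_count (50 * j) (Vj j) (Kj j) (mj j) ((1 / 2) ^ (j + 3)) (by positivity)
    (by
      calc ((1 : ℝ) / 2) ^ (j + 3) ≤ (1 / 2) ^ 1 :=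
            pow_le_pow_of_le_one (by norm_num) (by norm_num) (by omega)
        _ = 1 / 2 := pow_one _)
    (by
      unfold mj; push_cast
      rw [← pow_mul, mul_comm (j + 3) 4, ← mul_pow]; norm_num)
    (by
      have : Vj j < 3 ^ (Vj j) := Nat.lt_pow_self (by norm_num)
      have h2 : ((Vj j : ℕ) : ℤ) < 3 ^ (Vj j) := by exact_mod_cast this
      have h3 : ((Vj j : ℕ) : ℤ) = (mj j : ℤ) * 2 ^ (3 ^ (50 * j)) * 2 ^ (3 ^ (50 * j)) := by
        unfold Vj; push_cast; ring
      rw [h3] at h2; exact h2)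
    (by unfold Kj; omega)
    (Bj j) (by
      intro a ha n hn
      unfold Bj at ha
      exact (Finset.mem_filter.1 ha).2 n hn)
  refine h.trans (le_of_eq ?_)
  congr 1
  unfold mj
  push_cast
  rw [div_pow, ← pow_mul, ← pow_mul, ← pow_mul]
  rw [mul_div_assoc']
  congr 1
  rw [show 58 * j = 8 * j + 50 * j by ring, show 4 * (j + 3) * 2 = 24 + 8 * j by ring, pow_add,
    pow_add]
  ring

lemma bad_cover (M j : ℕ) (hM : M ≤ 3 ^ (50 * j)) :
    BadSet M ⊆ ⋃ a : {a // a ∈ Bj j}, Set.Icc (yy (Kj j) a) (yy (Kj j) a + (1 / 3) ^ (Kj j)) := by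
  intro x hx
  obtain ⟨hxC, hx⟩ := hx
  obtain ⟨a, h1, h2⟩ := pre_cover (Kj j) x (Set.mem_iInter.1 hxC _)
  refine Set.mem_iUnion.2 ⟨⟨a, ?_⟩, h1, h2⟩
  unfold Bj
  rw [Finset.mem_filter]
  refine ⟨Finset.mem_univ _, fun n hn => ?_⟩
  by_contra hlt
  push Not at hlt
  set N := 3 ^ (50 * j) + n with hN
  refine hx N (by omega) fun i hi1 hi2 => ?_
  have hl := log_bound j N (by have : 0 < 3 ^ (50 * j) := by positivity
                               omega) (by omega)
  refine works_of N (j + 1) x ⌊2 ^ N * yy (Kj j) a⌋ ?_ ?_ i hi1 (by omega)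
  · have := Int.floor_le (2 ^ N * yy (Kj j) a)
    have h3 : 2 ^ N * yy (Kj j) a ≤ 2 ^ N * x := by gcongr
    linarith
  · have hfr : (2 : ℝ) ^ N * yy (Kj j) a - ⌊2 ^ N * yy (Kj j) a⌋ < 2 * (1 / 2) ^ (j + 3) := hlt
    have h3 : (2 : ℝ) ^ N * x ≤ 2 ^ N * yy (Kj j) a + 2 ^ N * (1 / 3) ^ (Kj j) := by
      rw [← mul_add]; gcongr
    have h4 : (2 : ℝ) ^ N * (1 / 3) ^ (Kj j) ≤ (1 / 2) ^ (j + 3) := by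
      calc (2 : ℝ) ^ N * (1 / 3) ^ (Kj j) ≤ 2 ^ N * (1 / 2) ^ (Kj j) := by gcongr; norm_num
        _ ≤ 2 ^ N * (1 / 2) ^ (N + (j + 3)) := by
          refine mul_le_mul_of_nonneg_left ?_ (by positivity)
          exact pow_le_pow_of_le_one (by norm_num) (by norm_num) (by unfold Kj; omega)
        _ = (1 / 2) ^ (j + 3) := by
          rw [pow_add (1 / 2 : ℝ), ← mul_assoc, ← mul_pow]; norm_num
    have h5 : (2 : ℝ) ^ N * x - ⌊2 ^ N * yy (Kj j) a⌋ < 3 * (1 / 2) ^ (j + 3) := by linarith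
    have e : (2 : ℝ) ^ (j + 1) * (3 * (1 / 2) ^ (j + 3)) = 3 / 4 := by
      rw [show j + 3 = (j + 1) + 2 by ring, pow_add (1 / 2 : ℝ)]
      have : (2 : ℝ) ^ (j + 1) * (1 / 2) ^ (j + 1) = 1 := by rw [← mul_pow]; norm_num
      linear_combination (3 / 4 : ℝ) * this
    calc (2 : ℝ) ^ (j + 1) * (2 ^ N * x - ⌊2 ^ N * yy (Kj j) a⌋)
        < 2 ^ (j + 1) * (3 * (1 / 2) ^ (j + 3)) := by gcongr
      _ = 3 / 4 := e
      _ < 1 := by norm_num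

lemma bad_null (M : ℕ) : μH[Real.logb 3 2] (BadSet M) = 0 := by
  have hKj : ∀ j, j ≤ Kj j := fun j => by unfold Kj; omega
  have hdiam : ∀ j (a : {a // a ∈ Bj j}),
      Metric.ediam (Set.Icc (yy (Kj j) a) (yy (Kj j) a + (1 / 3) ^ (Kj j))) =
        ENNReal.ofReal ((1 / 3) ^ (Kj j)) := by
    intro j a
    rw [Real.ediam_Icc]; congr 1; ring
  have hle := Measure.hausdorffMeasure_le_liminf_sum (X := ℝ) (β := ℕ) (ι := fun j => {a // a ∈ Bj j})
    (Real.logb 3 2) (BadSet M) (l := atTop) (fun j => ENNReal.ofReal ((1 / 3) ^ j))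
    (by
      have := tendsto_pow_atTop_nhds_zero_of_lt_one (r := (1 / 3 : ℝ)) (by norm_num) (by norm_num)
      simpa using ENNReal.tendsto_ofReal this)
    (fun j a => Set.Icc (yy (Kj j) a) (yy (Kj j) a + (1 / 3) ^ (Kj j)))
    (Eventually.of_forall fun j a => by
      rw [hdiam]
      exact ENNReal.ofReal_le_ofReal
        (pow_le_pow_of_le_one (by norm_num) (by norm_num) (hKj j)))
    (by
      filter_upwards [eventually_ge_atTop M] with j hj
      refine bad_cover M j ?_
      calc M ≤ j := hj
        _ ≤ 50 * j := by omega
        _ ≤ 3 ^ (50 * j) := (Nat.lt_pow_self (by norm_num)).le)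
  have hterm : ∀ j, ∑ a : {a // a ∈ Bj j},
      Metric.ediam (Set.Icc (yy (Kj j) a) (yy (Kj j) a + (1 / 3) ^ (Kj j))) ^ (Real.logb 3 2) ≤
        ENNReal.ofReal (80 * 2 ^ 24 * (2 ^ 58 / 3 ^ 50) ^ j) := by
    intro j
    have hp : (((1 : ℝ) / 3) ^ (Kj j)) ^ (Real.logb 3 2) = (1 / 2) ^ (Kj j) := by
      rw [← Real.rpow_natCast, ← Real.rpow_mul (by norm_num), mul_comm, Real.rpow_mul (by norm_num),
        Real.rpow_natCast]
      congr 1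
      rw [one_div, Real.inv_rpow (by norm_num), Real.rpow_logb (by norm_num) (by norm_num) (by norm_num)]
      norm_num
    simp only [hdiam]
    rw [Finset.sum_const, ENNReal.ofReal_rpow_of_nonneg (by positivity)
      (Real.logb_nonneg (by norm_num) (by norm_num)), hp, nsmul_eq_mul, Finset.card_univ,
      Fintype.card_coe, ← ENNReal.ofReal_natCast, ← ENNReal.ofReal_mul (by positivity)]
    refine ENNReal.ofReal_le_ofReal ?_
    calc ((Bj j).card : ℝ) * (1 / 2) ^ (Kj j)
        ≤ (2 ^ (Kj j) * (80 * 2 ^ 24 * (2 ^ 58 / 3 ^ 50) ^ j)) * (1 / 2) ^ (Kj j) :=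
          mul_le_mul_of_nonneg_right (Bj_card j) (by positivity)
      _ = (2 ^ (Kj j) * (1 / 2) ^ (Kj j)) * (80 * 2 ^ 24 * (2 ^ 58 / 3 ^ 50) ^ j) := by ring
      _ = _ := by rw [← mul_pow]; norm_num
  have hlim : Tendsto (fun j : ℕ => ENNReal.ofReal (80 * 2 ^ 24 * (2 ^ 58 / 3 ^ 50) ^ j)) atTop
      (nhds 0) := by
    have := (tendsto_pow_atTop_nhds_zero_of_lt_one (r := (2 ^ 58 / 3 ^ 50 : ℝ)) (by positivity)
      (by norm_num)).const_mul (80 * 2 ^ 24)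
    rw [mul_zero] at this
    simpa only [ENNReal.ofReal_zero] using ENNReal.tendsto_ofReal this
  have h0 := tendsto_of_tendsto_of_tendsto_of_le_of_le tendsto_const_nhds hlim
    (fun _ => zero_le) hterm
  rw [h0.liminf_eq] at hle
  exact le_antisymm hle zero_le

theorem stmt3 :
    ∀ᵐ x ∂cantorMeasure, x ∈ Set.Icc (0 : ℝ) 1 →
      {n : ℕ | ∀ j : ℕ, n + 1 ≤ j → j ≤ n + ⌊0.01 * Real.logb 2 n⌋₊ →
        ⌊(2 : ℝ) ^ j * x⌋ % 2 = 0}.Infinite := by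
  unfold cantorMeasure
  rw [ae_restrict_iff' isClosed_cantorSet.measurableSet]
  have h : ∀ᵐ x ∂(μH[Real.logb 3 2] : Measure ℝ), ∀ M : ℕ, x ∉ BadSet M := by
    refine eventually_countable_forall.2 fun M => ?_
    have := bad_null M
    rwa [measure_eq_zero_iff_ae_notMem] at this
  filter_upwards [h] with x hx hxC _
  rw [Set.infinite_iff_exists_gt]
  intro M
  by_contra hcon
  refine hx (M + 1) ⟨hxC, fun n hn hw => hcon ⟨n, hw, by omega⟩⟩
end

section
/- Let ν denote the Lebesgue (Haar) probability measure on ℝ/ℤ. For every function ψ : ℕ → [0,∞) and every sequence (x_n)_{n≥1} in ℝ/ℤ, the set {x ∈ ℝ/ℤ : d(T_2^n(x), x_n) ≤ ψ(n) for infinitely many n ∈ ℕ} has ν-measure 0 if Σ_{n=1}^∞ ψ(n) < ∞, and ν-measure 1 if Σ_{n=1}^∞ ψ(n) = ∞. -/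
open MeasureTheory Filter

lemma aux_bc {Ω : Type*} [MeasurableSpace Ω] (μ : Measure Ω) [IsProbabilityMeasure μ]
    (A : ℕ → Set Ω) (hA : ∀ n, MeasurableSet (A n)) (p : ℕ → ℝ) (hp : ∀ n, μ.real (A n) = p n)
    (hns : ¬ Summable p)
    (hq : ∀ n, ∑ m ∈ Finset.range n, μ.real (A m ∩ A n) ≤ p n * (∑ m ∈ Finset.range n, p m + 1)) :
    ∀ᵐ x ∂μ, {n | x ∈ A n}.Infinite := by
  classical
  have hp0 : ∀ n, 0 ≤ p n := fun n => hp n ▸ measureReal_nonneg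
  set f : ℕ → Ω → ℝ := fun n => (A n).indicator 1 with hf
  set S : ℕ → Ω → ℝ := fun N x => ∑ n ∈ Finset.range N, f n x with hS
  set E : ℕ → ℝ := fun N => ∑ n ∈ Finset.range N, p n with hE
  have hfi : ∀ n, Integrable (f n) μ := fun n => (integrable_const (1:ℝ)).indicator (hA n)
  have hfint : ∀ n, ∫ x, f n x ∂μ = p n := by
    intro n
    rw [hf, ← hp n]
    exact integral_indicator_one (hA n)
  have hff : ∀ m n x, f m x * f n x = (A m ∩ A n).indicator 1 x := by
    intro m n x
    simp only [hf, Set.indicator_apply, Set.mem_inter_iff]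
    by_cases h1 : x ∈ A m <;> by_cases h2 : x ∈ A n <;> simp [h1, h2]
  have hffi : ∀ m n, Integrable (fun x => f m x * f n x) μ := by
    intro m n
    simp_rw [hff]
    exact (integrable_const (1:ℝ)).indicator ((hA m).inter (hA n))
  have hSi : ∀ N, Integrable (S N) μ := fun N => integrable_finsetSum _ (fun n _ => hfi n)
  have hSint : ∀ N, ∫ x, S N x ∂μ = E N := by
    intro N
    simp only [hS, hE]
    rw [integral_finsetSum _ (fun n _ => hfi n)]
    simp [hfint]
  have hSfi : ∀ N n, Integrable (fun x => S N x * f n x) μ := by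
    intro N n
    simp only [hS, Finset.sum_mul]
    exact integrable_finsetSum _ (fun m _ => hffi m n)
  have hSfint : ∀ N, ∫ x, S N x * f N x ∂μ ≤ p N * (E N + 1) := by
    intro N
    refine le_trans (le_of_eq ?_) (hq N)
    simp only [hS, Finset.sum_mul]
    rw [integral_finsetSum _ (fun m _ => hffi m N)]
    refine Finset.sum_congr rfl fun m _ => ?_
    simp_rw [hff]
    exact integral_indicator_one ((hA m).inter (hA N))
  have hsq : ∀ N, Integrable (fun x => S N x ^ 2) μ ∧ ∫ x, S N x ^ 2 ∂μ ≤ E N ^ 2 + 3 * E N := by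
    intro N
    induction N with
    | zero => simp [hS, hE]
    | succ N ih =>
      have h1 : (fun x => S (N+1) x ^ 2) = fun x => S N x ^ 2 + 2 * (S N x * f N x) + f N x := by
        funext x
        have : S (N+1) x = S N x + f N x := Finset.sum_range_succ _ _
        have h2 : f N x * f N x = f N x := by rw [hff, Set.inter_self]
        rw [this]; linear_combination h2
      have i1 : Integrable (fun x => S N x ^ 2 + 2 * (S N x * f N x)) μ := ih.1.add ((hSfi N N).const_mul 2)
      have hEs : E (N+1) = E N + p N := Finset.sum_range_succ _ _
      rw [h1]
      refine ⟨i1.add (hfi N), ?_⟩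
      rw [integral_add i1 (hfi N), integral_add ih.1 ((hSfi N N).const_mul 2),
        integral_const_mul, hfint, hEs]
      nlinarith [ih.2, hSfint N, sq_nonneg (p N)]
  have hEtop : Tendsto E atTop atTop := (not_summable_iff_tendsto_nat_atTop_of_nonneg hp0).1 hns
  have hcheb : ∀ (K : ℝ) N, K ≤ E N → (E N - K)^2 * μ.real {x | S N x ≤ K} ≤ 3 * E N := by
    intro K N hK
    have hvi : Integrable (fun x => (S N x - E N)^2) μ := by
      have : (fun x => (S N x - E N)^2) = fun x => S N x ^2 - (2 * E N) * S N x + E N ^ 2 := by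
        funext x; ring
      rw [this]
      exact ((hsq N).1.sub ((hSi N).const_mul _)).add (integrable_const _)
    have hv : ∫ x, (S N x - E N)^2 ∂μ ≤ 3 * E N := by
      have : (fun x => (S N x - E N)^2) = fun x => (S N x ^2 - (2 * E N) * S N x) + E N ^ 2 := by
        funext x; ring
      have i1 : Integrable (fun x => S N x ^2 - (2 * E N) * S N x) μ :=
        (hsq N).1.sub ((hSi N).const_mul _)
      rw [this, integral_add i1 (integrable_const _),
        integral_sub (hsq N).1 ((hSi N).const_mul _), integral_const_mul, hSint]
      simp only [integral_const, probReal_univ, smul_eq_mul, one_mul]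
      nlinarith [(hsq N).2]
    refine le_trans ?_ hv
    refine le_trans ?_ (mul_meas_ge_le_integral_of_nonneg
      (Eventually.of_forall fun x => sq_nonneg (S N x - E N)) hvi ((E N - K)^2))
    refine mul_le_mul_of_nonneg_left (measureReal_mono ?_) (sq_nonneg _)
    intro x hx
    simp only [Set.mem_ofPred_eq] at hx ⊢
    nlinarith
  have hK : ∀ K : ℕ, μ {x | ∀ N, S N x ≤ K} = 0 := by
    intro K
    by_contra hne
    set c := μ.real {x | ∀ N, S N x ≤ K} with hc
    have hc0 : 0 < c := ENNReal.toReal_pos hne (measure_ne_top _ _)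
    obtain ⟨N, h1, h2⟩ := ((hEtop.eventually_ge_atTop (2 * (K:ℝ) + 1)).and
      (hEtop.eventually_gt_atTop (12 / c))).exists
    have h3 := hcheb K N (by have : (0:ℝ) ≤ K := K.cast_nonneg
                             linarith)
    have h4 : c ≤ μ.real {x | S N x ≤ K} := measureReal_mono fun x hx => hx N
    have hK0 : (0:ℝ) ≤ K := K.cast_nonneg
    have h5 : (E N / 2)^2 * c ≤ 3 * E N := by
      refine le_trans ?_ h3
      have h6 : E N / 2 ≤ E N - K := by linarith
      have h7 : 0 ≤ E N / 2 := by linarith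
      gcongr
    rw [div_lt_iff₀ hc0] at h2
    nlinarith
  have hall : ∀ᵐ x ∂μ, ∀ K : ℕ, ¬ ∀ N, S N x ≤ K := by
    rw [ae_all_iff]
    intro K
    rw [ae_iff]
    simpa using hK K
  filter_upwards [hall] with x hx
  intro hfin
  apply hx hfin.toFinset.card
  intro N
  have : S N x = (((Finset.range N).filter (fun n => x ∈ A n)).card : ℝ) := by
    simp [hS, hf, Set.indicator_apply]
  rw [this]
  norm_cast
  apply Finset.card_le_card
  intro n hn
  simpa using (Finset.mem_filter.1 hn).2

lemma aux_mix (x y : AddCircle (1:ℝ)) (r s : ℝ) (hr0 : 0 ≤ r) (hr : r ≤ 1/2) (k : ℕ) (hk : 0 < k) :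
    (volume : Measure (AddCircle (1:ℝ))).real
      (Metric.closedBall x r ∩ {z | (k:ℤ) • z ∈ Metric.closedBall y s}) ≤
    (2 * r + 1 / k) * (volume : Measure (AddCircle (1:ℝ))).real (Metric.closedBall y s) := by
  obtain ⟨a, rfl⟩ := QuotientAddGroup.mk_surjective x
  have hk' : (0:ℝ) < k := by exact_mod_cast hk
  set B : Set ℝ := (fun t : ℝ => (t : AddCircle (1:ℝ))) ⁻¹' Metric.closedBall y s with hB
  have hmk : Measurable (fun t : ℝ => (t : AddCircle (1:ℝ))) := AddCircle.measurable_mk'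
  have hBm : MeasurableSet B := hmk Metric.isClosed_closedBall.measurableSet
  set g : ℝ → ℝ := B.indicator 1 with hg
  have hgp : Function.Periodic g 1 := by
    intro t
    have : t + 1 ∈ B ↔ t ∈ B := by
      simp only [hB, Set.mem_preimage, AddCircle.coe_add_period]
    by_cases h : t ∈ B
    · rw [hg, Set.indicator_of_mem h, Set.indicator_of_mem (this.2 h)]; rfl
    · rw [hg, Set.indicator_of_notMem h, Set.indicator_of_notMem (fun h' => h (this.1 h'))]
  have hgi : ∀ u v, IntervalIntegrable g volume u v := by
    intro u v
    rw [intervalIntegrable_iff]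
    exact (integrableOn_const (by simp [Set.uIoc]) (by simp)).indicator hBm
  have hreal : ∀ (c : ℝ) (D : Set (AddCircle (1:ℝ))), MeasurableSet D →
      (volume : Measure (AddCircle (1:ℝ))).real D =
      (volume : Measure ℝ).real ((fun t : ℝ => (t : AddCircle (1:ℝ))) ⁻¹' D ∩ Set.Ioc c (c+1)) := by
    intro c D hD
    have := (AddCircle.measurePreserving_mk (1:ℝ) c).measure_preimage hD.nullMeasurableSet
    rw [Measure.restrict_apply (hmk hD)] at this
    rw [Measure.real, Measure.real, ← this]
  have hint1 : ∀ c, ∫ t in c..(c+1), g t =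
      (volume : Measure (AddCircle (1:ℝ))).real (Metric.closedBall y s) := by
    intro c
    rw [hreal c _ Metric.isClosed_closedBall.measurableSet,
      intervalIntegral.integral_of_le (by linarith), hg, integral_indicator_one hBm,
      measureReal_restrict_apply hBm]
  set V := (volume : Measure (AddCircle (1:ℝ))).real (Metric.closedBall y s) with hV
  set M : ℕ := ⌈2 * r * k⌉₊ with hM
  have hMle : (M:ℝ) ≤ 2 * r * k + 1 := (Nat.ceil_lt_add_one (by positivity)).le
  have hMge : 2 * r * k ≤ M := Nat.le_ceil _
  set b := a - r with hb
  have hintM : ∫ t in b..(b + M / k), g (k * t) = M / k * V := by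
    rw [intervalIntegral.integral_comp_mul_left _ hk'.ne']
    have e : (k:ℝ) * (b + M / k) = k * b + (M:ℤ) • (1:ℝ) := by
      simp; field_simp
    rw [e, hgp.intervalIntegral_add_zsmul_eq, hint1]
    · simp
      ring
    · exact hgi
  have hgkm : MeasurableSet ((fun t : ℝ => (k:ℝ) * t) ⁻¹' B) := (measurable_const_mul _) hBm
  have hD : MeasurableSet (Metric.closedBall (a : AddCircle (1:ℝ)) r ∩
      {z | (k:ℤ) • z ∈ Metric.closedBall y s}) := by
    refine Metric.isClosed_closedBall.measurableSet.inter ?_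
    exact (Metric.isClosed_closedBall.preimage (continuous_zsmul (k:ℤ))).measurableSet
  have hlast : M / k * V ≤ (2 * r + 1 / k) * V := by
    refine mul_le_mul_of_nonneg_right ?_ measureReal_nonneg
    rw [div_le_iff₀ hk', add_mul]
    field_simp
    linarith
  refine le_trans ?_ hlast
  have hle : b ≤ b + M / k := by
    have : (0:ℝ) ≤ M / k := by positivity
    linarith
  have hset : ∫ t in b..(b + M / k), g (k * t) =
      (volume : Measure ℝ).real ((fun t : ℝ => (k:ℝ) * t) ⁻¹' B ∩ Set.Icc b (b + M/k)) := by
    rw [intervalIntegral.integral_of_le hle, ← integral_Icc_eq_integral_Ioc]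
    have : (fun t : ℝ => g (k * t)) = ((fun t : ℝ => (k:ℝ) * t) ⁻¹' B).indicator 1 := by
      funext t; rfl
    rw [this, integral_indicator_one hgkm, measureReal_restrict_apply hgkm]
  rw [← hintM, hset, hreal (a - 1/2) _ hD]
  refine measureReal_mono ?_ ?_
  · rintro t ⟨⟨h1, h2⟩, h3⟩
    have h3' : t ∈ Metric.closedBall a (|(1:ℝ)|/2) := by
      rw [Real.closedBall_eq_Icc, abs_one]
      exact ⟨h3.1.le, by linarith [h3.2]⟩
    have hx := AddCircle.coe_real_preimage_closedBall_inter_eq (p := (1:ℝ)) (x := a) (ε := r)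
      (Metric.closedBall a (|(1:ℝ)|/2)) subset_rfl
    have hmem : t ∈ Metric.closedBall a r := by
      have : t ∈ (fun t : ℝ => (t : AddCircle (1:ℝ))) ⁻¹' Metric.closedBall (a : AddCircle (1:ℝ)) r
        ∩ Metric.closedBall a (|(1:ℝ)|/2) := ⟨h1, h3'⟩
      erw [hx] at this
      split_ifs at this with hlt
      · exact this.1
      · rw [abs_one] at this hlt
        exact Metric.closedBall_subset_closedBall (by linarith) this
    rw [Real.closedBall_eq_Icc] at hmem
    refine ⟨?_, hmem.1, hmem.2.trans ?_⟩
    · simp only [Set.mem_ofPred_eq] at h2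
      simp only [hB, Set.mem_preimage]
      convert h2 using 1
      rw [← AddCircle.coe_zsmul]
      simp
    · have : 2 * r ≤ M / k := by rwa [le_div_iff₀ hk']
      simp only [hb]; linarith
  · exact ((measure_mono Set.inter_subset_right).trans_lt measure_Icc_lt_top).ne

lemma aux_mp (n : ℕ) : MeasurePreserving (fun z : AddCircle (1:ℝ) => (2^n : ℤ) • z) := by
  exact MeasureTheory.Measure.measurePreserving_zsmul _ (by positivity)

/-- Khintchine-type theorem for the doubling map and Lebesgue (Haar) measure `ν` on
`ℝ/ℤ`: the set `{x : d(T₂ⁿ x, x_n) ≤ ψ(n) for infinitely many n}` has `ν`-measure `0`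
if `∑ ψ(n) < ∞` and `ν`-measure `1` if `∑ ψ(n) = ∞`. -/
theorem stmt19 (ψ : ℕ → ℝ) (hψ : ∀ n, 0 ≤ ψ n) (xs : ℕ → AddCircle (1 : ℝ)) :
    (Summable ψ →
      volume {x : AddCircle (1 : ℝ) |
        {n : ℕ | dist ((2 ^ n : ℤ) • x) (xs n) ≤ ψ n}.Infinite} = 0) ∧
    (¬ Summable ψ →
      volume {x : AddCircle (1 : ℝ) |
        {n : ℕ | dist ((2 ^ n : ℤ) • x) (xs n) ≤ ψ n}.Infinite} = 1) := by
  constructor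
  · intro h
    have hvol : ∀ n, volume {x : AddCircle (1:ℝ) | dist ((2 ^ n : ℤ) • x) (xs n) ≤ ψ n} ≤
        ENNReal.ofReal (2 * ψ n) := by
      intro n
      have := (aux_mp n).measure_preimage
        (Metric.isClosed_closedBall (x := xs n) (ε := ψ n)).measurableSet.nullMeasurableSet
      refine (le_of_eq this).trans ?_
      rw [AddCircle.volume_closedBall]
      exact ENNReal.ofReal_le_ofReal (min_le_right _ _)
    have hs : ∑' n, volume {x : AddCircle (1:ℝ) | dist ((2 ^ n : ℤ) • x) (xs n) ≤ ψ n} ≠ ⊤ :=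
      ne_top_of_le_ne_top (h.mul_left 2).tsum_ofReal_ne_top (ENNReal.tsum_le_tsum hvol)
    have := ae_finite_setOfPred_mem hs
    rw [ae_iff] at this
    exact this
  · intro h
    set r : ℕ → ℝ := fun n => min (ψ n) (1/2) with hr
    have hr0 : ∀ n, 0 ≤ r n := fun n => le_min (hψ n) (by norm_num)
    have hr2 : ∀ n, r n ≤ 1/2 := fun n => min_le_right _ _
    have hrs : ¬ Summable r := by
      intro hs
      apply h
      refine (summable_congr_atTop ?_).1 hs
      filter_upwards [hs.tendsto_atTop_zero.eventually_lt_const (show (0:ℝ) < 1/2 by norm_num)]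
        with n hn
      simp only [hr] at hn ⊢
      rcases min_lt_iff.1 hn with h1 | h1
      · exact min_eq_left h1.le
      · exact absurd h1 (lt_irrefl _)
    have hball : ∀ n, (volume : Measure (AddCircle (1:ℝ))).real
        (Metric.closedBall (xs n) (r n)) = 2 * r n := by
      intro n
      rw [Measure.real, AddCircle.volume_closedBall, min_eq_right (by linarith [hr2 n]),
        ENNReal.toReal_ofReal (by linarith [hr0 n])]
    set A : ℕ → Set (AddCircle (1:ℝ)) :=
      fun n => (fun z : AddCircle (1:ℝ) => (2^n : ℤ) • z) ⁻¹' Metric.closedBall (xs n) (r n) with hA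
    have hAm : ∀ n, MeasurableSet (A n) := fun n =>
      (aux_mp n).measurable Metric.isClosed_closedBall.measurableSet
    have hpres : ∀ n (D : Set (AddCircle (1:ℝ))), MeasurableSet D →
      (volume : Measure (AddCircle (1:ℝ))).real ((fun z : AddCircle (1:ℝ) => (2^n : ℤ) • z) ⁻¹' D)
        = (volume : Measure (AddCircle (1:ℝ))).real D := by
      intro n D hD
      rw [Measure.real, (aux_mp n).measure_preimage hD.nullMeasurableSet, Measure.real]
    haveI : IsProbabilityMeasure (volume : Measure (AddCircle (1:ℝ))) :=
      ⟨by simp [AddCircle.measure_univ]⟩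
    have hmain := aux_bc volume A hAm (fun n => 2 * r n)
      (fun n => by rw [hA, hpres n _ Metric.isClosed_closedBall.measurableSet, hball])
      (by rwa [summable_mul_left_iff (by norm_num)]) (by
        intro n
        have hmn : ∀ m ∈ Finset.range n, (volume : Measure (AddCircle (1:ℝ))).real (A m ∩ A n) ≤
            (2 * r m + (1/2)^(n-m)) * (2 * r n) := by
          intro m hm
          have hm' : m < n := Finset.mem_range.1 hm
          have := aux_mix (xs m) (xs n) (r m) (r n) (hr0 m) (hr2 m) (2^(n-m)) (by positivity)
          rw [hball] at this
          have e : A m ∩ A n = (fun z : AddCircle (1:ℝ) => (2^m : ℤ) • z) ⁻¹'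
            (Metric.closedBall (xs m) (r m) ∩
              {z | ((2^(n-m) : ℕ):ℤ) • z ∈ Metric.closedBall (xs n) (r n)}) := by
            rw [Set.preimage_inter]
            congr 1
            ext z
            simp only [hA, Set.mem_preimage, Set.mem_ofPred_eq]
            rw [smul_smul]
            push_cast
            rw [← pow_add, Nat.sub_add_cancel hm'.le]
          rw [e, hpres]
          · convert this using 3
            push_cast
            rw [one_div_pow]
          · refine Metric.isClosed_closedBall.measurableSet.inter ?_
            exact (Metric.isClosed_closedBall.preimage (continuous_zsmul _)).measurableSet
        refine (Finset.sum_le_sum hmn).trans ?_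
        rw [← Finset.sum_mul, mul_comm, Finset.sum_add_distrib]
        have hgeo : ∀ n : ℕ, ∑ m ∈ Finset.range n, (1/2:ℝ)^(n-m) ≤ 1 := by
          intro n
          induction n with
          | zero => simp
          | succ n ih =>
            rw [Finset.sum_range_succ]
            have : ∑ m ∈ Finset.range n, (1/2:ℝ)^(n+1-m) =
                1/2 * ∑ m ∈ Finset.range n, (1/2:ℝ)^(n-m) := by
              rw [Finset.mul_sum]
              refine Finset.sum_congr rfl fun m hm => ?_
              rw [Nat.sub_add_comm (Finset.mem_range.1 hm).le, pow_succ']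
            rw [this]
            rw [Nat.add_sub_cancel_left]
            linarith
        have := hgeo n
        have := hr0 n
        gcongr)
    refine (measure_congr (eventuallyEq_univ.2 ?_)).trans measure_univ
    filter_upwards [hmain] with x hinf
    refine Set.Infinite.mono ?_ hinf
    intro n hn
    have hn' : dist ((2 ^ n : ℤ) • x) (xs n) ≤ r n := hn
    exact le_trans hn' (min_le_left _ _)
end
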